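/- Let H = {x ∈ ℝ³ : x₃ > 0} be an open halfspace. There is no complete conformal minimal immersion ψ : 𝔻 → H of the open unit disk into H that is proper in H and whose limit set closure(ψ(𝔻)) \ ψ(𝔻) is a bounded subset of ℝ³. Equivalently, the limit set of any complete minimal disk properly immersed in an open halfspace is unbounded. -/

import Mathlib

open Set Metric Function

noncomputable section

/-- ℝ³, identified with `EuclideanSpace ℝ (Fin 3)`. -/
abbrev R3 := EuclideanSpace ℝ (Fin 3)

/-- A real function on `ℂ ≃ ℝ²` is harmonic on a set if its Laplacian vanishes there. -/
def HarmOn (f : ℂ → ℝ) (Ω : Set ℂ) : Prop :=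
  ∀ z ∈ Ω,
    fderiv ℝ (fun w => fderiv ℝ f w 1) z 1 +
      fderiv ℝ (fun w => fderiv ℝ f w Complex.I) z Complex.I = 0

/-- A conformal minimal immersion on an open set `Ω ⊆ ℂ`: a smooth map whose coordinate
functions are harmonic and whose real derivative at each point of `Ω` is a positive scalar
multiple of a linear isometry (hence injective and conformal). -/
def ConfMinImmOn (X : ℂ → R3) (Ω : Set ℂ) : Prop :=
  ContDiffOn ℝ (⊤ : ℕ∞) X Ω ∧
  (∀ i : Fin 3, HarmOn (fun z => X z i) Ω) ∧
  ∀ z ∈ Ω, ∃ c : ℝ, 0 < c ∧ ∀ v : ℂ, ‖fderiv ℝ X z v‖ = c * ‖v‖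

/-- A path `γ : [0,1) → Ω` that eventually leaves every compact subset of `Ω`. -/
def DivergentPath (Ω : Set ℂ) (γ : ℝ → ℂ) : Prop :=
  ContinuousOn γ (Ico 0 1) ∧ MapsTo γ (Ico 0 1) Ω ∧
  ∀ K : Set ℂ, IsCompact K → K ⊆ Ω →
    ∃ t₀ ∈ Ico (0:ℝ) 1, ∀ t ∈ Ico t₀ 1, γ t ∉ K

/-- Completeness of an immersion `X` on `Ω`: every divergent path has image of infinite
total variation (length). -/
def CompleteOn (X : ℂ → R3) (Ω : Set ℂ) : Prop :=
  ∀ γ : ℝ → ℂ, DivergentPath Ω γ → eVariationOn (X ∘ γ) (Ico 0 1) = ⊤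

/-- Properness of `ψ : Ω → D`: preimages of compact subsets of `D` are compact. -/
def ProperIn (ψ : ℂ → R3) (Ω : Set ℂ) (D : Set R3) : Prop :=
  ∀ K : Set R3, IsCompact K → K ⊆ D → IsCompact (Ω ∩ ψ ⁻¹' K)

/-- The limit set of a map on the open unit disk. -/
def limitSet (ψ : ℂ → R3) : Set R3 :=
  closure (ψ '' ball (0:ℂ) 1) \ ψ '' ball (0:ℂ) 1

/-- A regular strictly convex bounded domain: a nonempty bounded convex open set satisfying
uniform interior and exterior sphere conditions. -/
def RegStrictConvexDomain (C : Set R3) : Prop :=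
  C.Nonempty ∧ IsOpen C ∧ Convex ℝ C ∧ Bornology.IsBounded C ∧
  ∃ r R : ℝ, 0 < r ∧ r ≤ R ∧
    ∀ p ∈ frontier C,
      (∃ x, p ∈ sphere x r ∧ closedBall x r ⊆ closure C) ∧
      (∃ y, p ∈ sphere y R ∧ closure C ⊆ closedBall y R)

/-- `R` is a uniform exterior sphere radius for `E`. -/
def ExtSphereRadius (E : Set R3) (R : ℝ) : Prop :=
  0 < R ∧ ∀ p ∈ frontier E, ∃ y, p ∈ sphere y R ∧ closure E ⊆ closedBall y R

/-- `γ : ℝ → ℝ³`, `1`-periodic, parametrizes a smooth Jordan curve: it is `C^∞`, injective on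
a period, and has nowhere-vanishing derivative. -/
def SmoothJordan (γ : ℝ → R3) : Prop :=
  ContDiff ℝ (⊤ : ℕ∞) γ ∧ Periodic γ 1 ∧
  (∀ s ∈ Ico (0:ℝ) 1, ∀ t ∈ Ico (0:ℝ) 1, γ s = γ t → s = t) ∧
  ∀ t, deriv γ t ≠ 0

/-- `p : ℝ → ℂ`, `1`-periodic, parametrizes a polygon: an injective piecewise-linear loop. -/
def PolygonParam (p : ℝ → ℂ) : Prop :=
  Continuous p ∧ Periodic p 1 ∧
  (∀ s ∈ Ico (0:ℝ) 1, ∀ t ∈ Ico (0:ℝ) 1, p s = p t → s = t) ∧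
  ∃ n : ℕ, 0 < n ∧ ∀ k : ℕ, k < n → ∀ s ∈ Icc ((k:ℝ)/n) ((k+1)/n),
    p s = p (k/n) + (((s - k/n) * n) : ℝ) • (p ((k+1)/n) - p (k/n))

/-- The interior region of a polygon `P ⊆ ℂ`: the union of the bounded connected components
of the complement of `P`. -/
def polyInt (P : Set ℂ) : Set ℂ :=
  {z | z ∉ P ∧ Bornology.IsBounded (connectedComponentIn Pᶜ z)}

/-- The intrinsic distance, induced by `X`, within `W` from a point `z` to a set `S`:
the infimum of the lengths (total variations) of `X ∘ α` over continuous paths `α` in `W`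
joining `z` to `S`. -/
def intrinsicDist (X : ℂ → R3) (W : Set ℂ) (z : ℂ) (S : Set ℂ) : ENNReal :=
  ⨅ (α : ℝ → ℂ) (_ : ContinuousOn α (Icc 0 1)) (_ : MapsTo α (Icc 0 1) W)
    (_ : α 0 = z) (_ : α 1 ∈ S), eVariationOn (X ∘ α) (Icc 0 1)

/-- Two `1`-periodic loops in `ℝ³` are freely homotopic within a set `T`. -/
def HomotopicLoopsIn (T : Set R3) (f g : ℝ → R3) : Prop :=
  ∃ H : ℝ × ℝ → R3, Continuous H ∧
    (∀ t, H (t, 0) = f t) ∧ (∀ t, H (t, 1) = g t) ∧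
    (∀ t s, H (t + 1, s) = H (t, s)) ∧
    ∀ t s, s ∈ Icc (0:ℝ) 1 → H (t, s) ∈ T

/-- The inner parallel body `E₋ₜ` of a convex open set. -/
def innerParallel (E : Set R3) (t : ℝ) : Set R3 :=
  {x ∈ E | t < infDist x Eᶜ}

open scoped Topology

/-- `g` is differentiable near `0`, with `g' 0 = p` and `g'' 0 = s`. -/
def HasJetTwo (g : ℝ → ℝ) (p s : ℝ) : Prop :=
  ∃ g' : ℝ → ℝ, (∀ᶠ t in 𝓝 (0 : ℝ), HasDerivAt g (g' t) t) ∧ g' 0 = p ∧ HasDerivAt g' s 0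

theorem HasJetTwo.hasDerivAt {g : ℝ → ℝ} {p s : ℝ} (h : HasJetTwo g p s) :
    HasDerivAt g p 0 := by
  obtain ⟨g', h₁, rfl, -⟩ := h
  exact h₁.self_of_nhds

theorem HasJetTwo.affine (a b : ℝ) : HasJetTwo (fun t => a + t * b) b 0 := by
  refine ⟨fun _ => b, Filter.Eventually.of_forall fun t => ?_, rfl, hasDerivAt_const _ _⟩
  simpa using ((hasDerivAt_id t).mul_const b).const_add a

theorem HasJetTwo.const (a : ℝ) : HasJetTwo (fun _ => a) 0 0 := by
  simpa using HasJetTwo.affine a 0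

theorem HasJetTwo.add {f g : ℝ → ℝ} {p s q r : ℝ} (hf : HasJetTwo f p s)
    (hg : HasJetTwo g q r) : HasJetTwo (fun t => f t + g t) (p + q) (s + r) := by
  obtain ⟨f', f₁, rfl, f₂⟩ := hf
  obtain ⟨g', g₁, rfl, g₂⟩ := hg
  exact ⟨fun t => f' t + g' t, by filter_upwards [f₁, g₁] with t h k using h.add k, rfl,
    f₂.add g₂⟩

theorem HasJetTwo.mul {f g : ℝ → ℝ} {p s q r : ℝ} (hf : HasJetTwo f p s)
    (hg : HasJetTwo g q r) :
    HasJetTwo (fun t => f t * g t) (p * g 0 + f 0 * q) (s * g 0 + 2 * (p * q) + f 0 * r) := by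
  have hf0 := hf.hasDerivAt
  have hg0 := hg.hasDerivAt
  obtain ⟨f', f₁, rfl, f₂⟩ := hf
  obtain ⟨g', g₁, rfl, g₂⟩ := hg
  refine ⟨fun t => f' t * g t + f t * g' t,
    by filter_upwards [f₁, g₁] with t h k using h.mul k, rfl, ?_⟩
  exact ((f₂.mul hg0).add (hf0.mul g₂)).congr_deriv (by ring)

theorem HasJetTwo.log {f : ℝ → ℝ} {p s : ℝ} (hf : HasJetTwo f p s) (h0 : f 0 ≠ 0) :
    HasJetTwo (fun t => Real.log (f t)) (p / f 0) (s / f 0 - p ^ 2 / f 0 ^ 2) := by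
  have hf0 := hf.hasDerivAt
  obtain ⟨f', f₁, rfl, f₂⟩ := hf
  refine ⟨fun t => f' t / f t, ?_, rfl, (f₂.div hf0 h0).congr_deriv (by field_simp)⟩
  filter_upwards [f₁, hf0.continuousAt.eventually_ne h0] with t h k using h.log k

theorem HasJetTwo.nonpos_of_isLocalMax {g : ℝ → ℝ} {p s : ℝ} (hg : HasJetTwo g p s)
    (hm : IsLocalMax g 0) : s ≤ 0 := by
  have hg0 := hg.hasDerivAt
  obtain ⟨g', h₁, rfl, h₂⟩ := hg
  by_contra! hs
  have hd : deriv g =ᶠ[𝓝 0] g' := by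
    filter_upwards [h₁] with t ht using ht.deriv
  have hdd : deriv (deriv g) 0 = s := by rw [hd.deriv_eq, h₂.deriv]
  have hmin : IsLocalMin g 0 := isLocalMin_of_deriv_deriv_pos (by rw [hdd]; exact hs)
    (hm.deriv_eq_zero) hg0.continuousAt
  have hc : g =ᶠ[𝓝 0] fun _ => g 0 := by
    filter_upwards [hm, hmin] with t h k using le_antisymm h k
  have : deriv (deriv g) 0 = 0 := by rw [hc.deriv.deriv_eq]; simp
  linarith

/-- The restriction of a `C²` function to a line has the expected second derivative. -/
theorem ContDiffAt.hasJetTwo {f : ℂ → ℝ} {z : ℂ} (hf : ContDiffAt ℝ 2 f z) (e : ℂ) :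
    HasJetTwo (fun t : ℝ => f (z + t * e)) (fderiv ℝ f z e)
      (fderiv ℝ (fun w => fderiv ℝ f w e) z e) := by
  have hl : ∀ t : ℝ, HasDerivAt (fun t : ℝ => z + t * e) e t := fun t => by
    simpa using ((Complex.ofRealCLM.hasDerivAt (x := t)).mul_const e).const_add z
  have hl0 : Filter.Tendsto (fun t : ℝ => z + t * e) (𝓝 0) (𝓝 z) := by
    simpa using (hl 0).continuousAt.tendsto
  refine ⟨fun t => fderiv ℝ f (z + t * e) e, ?_, by simp, ?_⟩
  · have : ∀ᶠ w in 𝓝 z, DifferentiableAt ℝ f w :=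
      (hf.eventually (by simp)).mono fun w hw => hw.differentiableAt (by simp)
    filter_upwards [hl0.eventually this] with t ht using ht.hasFDerivAt.comp_hasDerivAt t (hl t)
  · have h1 : DifferentiableAt ℝ (fderiv ℝ f) z :=
      (hf.fderiv_right (m := 1) (by norm_num)).differentiableAt (by simp)
    have h2 : DifferentiableAt ℝ (fun w => fderiv ℝ f w e) z :=
      h1.clm_apply (differentiableAt_const e)
    have h3 : HasFDerivAt (fun w => fderiv ℝ f w e) (fderiv ℝ (fun w => fderiv ℝ f w e) z)
        (z + (0 : ℝ) * e) := by simpa using h2.hasFDerivAt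
    exact h3.comp_hasDerivAt (0 : ℝ) (hl 0)

theorem HarmOn.harmonicOnNhd {f : ℂ → ℝ} {Ω : Set ℂ} (hΩ : IsOpen Ω) (hf : ContDiffOn ℝ 2 f Ω)
    (h : HarmOn f Ω) : InnerProductSpace.HarmonicOnNhd f Ω := by
  intro z hz
  refine ⟨hf.contDiffAt (hΩ.mem_nhds hz), ?_⟩
  filter_upwards [hΩ.mem_nhds hz] with w hw
  have hw' := h w hw
  have h1 : DifferentiableAt ℝ (fderiv ℝ f) w :=
    ((hf.contDiffAt (hΩ.mem_nhds hw)).fderiv_right (m := 1) (by norm_num)).differentiableAt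
      (by simp)
  have key : ∀ e : ℂ, fderiv ℝ (fun w => fderiv ℝ f w e) w e = fderiv ℝ (fderiv ℝ f) w e e := by
    intro e
    rw [fderiv_clm_apply h1 (differentiableAt_const e)]
    simp
  rw [key, key] at hw'
  rw [InnerProductSpace.laplacian_eq_iteratedFDeriv_complexPlane]
  simpa [iteratedFDeriv_two_apply] using hw'

/-- Strong maximum principle on the disk. -/
theorem InnerProductSpace.HarmonicOnNhd.eqOn_const_of_isMaxOn {f : ℂ → ℝ} {c z₀ : ℂ} {r : ℝ}
    (hf : HarmonicOnNhd f (ball c r)) (hz : z₀ ∈ ball c r)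
    (hm : IsMaxOn f (ball c r) z₀) : ∀ z ∈ ball c r, f z = f z₀ := by
  obtain ⟨F, hF, hre⟩ := hf.exists_analyticOnNhd_ball_re_eq
  have hn : ∀ z ∈ ball c r, ‖Complex.exp (F z)‖ = Real.exp (f z) := fun z hz => by
    rw [Complex.norm_exp]; exact congrArg _ (hre hz)
  have := Complex.eqOn_of_isPreconnected_of_isMaxOn_norm (f := fun z => Complex.exp (F z))
    (convex_ball c r).isPreconnected isOpen_ball hF.differentiableOn.cexp hz (by
      intro z hz'
      have := hm hz'
      simp only [mem_ofPred_eq, Function.comp_apply] at this ⊢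
      rw [hn z hz', hn z₀ hz]
      exact Real.exp_le_exp.2 this)
  intro z hz'
  have h := congrArg norm (this hz')
  simp only [Function.const_apply] at h
  rw [hn z hz', hn z₀ hz] at h
  exact Real.exp_injective h

/-- The pointwise inequality behind superharmonicity of `log r - x₃ ^ 2` on minimal surfaces. -/
theorem conformal_inequality {x₁ x₂ p₁ p₂ p₃ q₁ q₂ q₃ : ℝ}
    (hp : p₁ ^ 2 + p₂ ^ 2 + p₃ ^ 2 = q₁ ^ 2 + q₂ ^ 2 + q₃ ^ 2)
    (hpq : p₁ * q₁ + p₂ * q₂ + p₃ * q₃ = 0) (hx : 1 ≤ x₁ ^ 2 + x₂ ^ 2) :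
    (p₁ ^ 2 + p₂ ^ 2 + q₁ ^ 2 + q₂ ^ 2) / (x₁ ^ 2 + x₂ ^ 2)
      - 2 * ((x₁ * p₁ + x₂ * p₂) ^ 2 + (x₁ * q₁ + x₂ * q₂) ^ 2) / (x₁ ^ 2 + x₂ ^ 2) ^ 2
      - 2 * (p₃ ^ 2 + q₃ ^ 2) ≤ 0 := by
  set ρ := x₁ ^ 2 + x₂ ^ 2 with hρ
  let φ₃ : ℂ := ⟨p₃, q₃⟩
  let a : ℂ := ⟨x₁ * p₁ + x₂ * p₂, x₁ * q₁ + x₂ * q₂⟩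
  let b : ℂ := ⟨x₁ * p₂ - x₂ * p₁, x₁ * q₂ - x₂ * q₁⟩
  have hab : b ^ 2 = -(a ^ 2 + ρ * φ₃ ^ 2) := by
    apply Complex.ext
    · simp [a, b, φ₃, pow_two]
      linear_combination ρ * hp
    · simp [a, b, φ₃, pow_two]
      linear_combination 2 * ρ * hpq
  have hsq : ∀ w : ℂ, ‖w‖ ^ 2 = w.re ^ 2 + w.im ^ 2 := fun w => by
    rw [Complex.sq_norm, Complex.normSq_apply]; ring
  have hn : ‖b‖ ^ 2 ≤ ‖a‖ ^ 2 + ρ * ‖φ₃‖ ^ 2 := by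
    calc ‖b‖ ^ 2 = ‖a ^ 2 + ρ * φ₃ ^ 2‖ := by rw [← norm_pow, hab, norm_neg]
      _ ≤ ‖a ^ 2‖ + ‖(ρ : ℂ) * φ₃ ^ 2‖ := norm_add_le _ _
      _ = ‖a‖ ^ 2 + ρ * ‖φ₃‖ ^ 2 := by
        rw [norm_mul, norm_pow, norm_pow, Complex.norm_real, Real.norm_of_nonneg (by linarith)]
  rw [hsq, hsq, hsq] at hn
  simp only [a, b, φ₃] at hn
  have hsum : (p₁ ^ 2 + p₂ ^ 2 + q₁ ^ 2 + q₂ ^ 2) * ρ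
      = ((x₁ * p₁ + x₂ * p₂) ^ 2 + (x₁ * q₁ + x₂ * q₂) ^ 2)
        + ((x₁ * p₂ - x₂ * p₁) ^ 2 + (x₁ * q₂ - x₂ * q₁) ^ 2) := by rw [hρ]; ring
  have hρ0 : 0 < ρ := by linarith
  have : (p₁ ^ 2 + p₂ ^ 2 + q₁ ^ 2 + q₂ ^ 2) / ρ
      - 2 * ((x₁ * p₁ + x₂ * p₂) ^ 2 + (x₁ * q₁ + x₂ * q₂) ^ 2) / ρ ^ 2
      = ((p₁ ^ 2 + p₂ ^ 2 + q₁ ^ 2 + q₂ ^ 2) * ρ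
        - 2 * ((x₁ * p₁ + x₂ * p₂) ^ 2 + (x₁ * q₁ + x₂ * q₂) ^ 2)) / ρ ^ 2 := by
    field_simp
  rw [this, hsum, sub_nonpos, div_le_iff₀ (by positivity)]
  have h3 : 0 ≤ p₃ ^ 2 + q₃ ^ 2 := by positivity
  nlinarith [mul_nonneg h3 hρ0.le, mul_nonneg (mul_nonneg h3 hρ0.le) (sub_nonneg.2 hx)]

/-- `f` has Laplacian `L` at `z`, computed along the coordinate lines. -/
def HasLap (f : ℂ → ℝ) (z : ℂ) (L : ℝ) : Prop :=
  ∃ p s q r : ℝ, HasJetTwo (fun t : ℝ => f (z + t * 1)) p s ∧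
    HasJetTwo (fun t : ℝ => f (z + t * Complex.I)) q r ∧ s + r = L

theorem HasLap.add {f g : ℂ → ℝ} {z : ℂ} {L M : ℝ} (hf : HasLap f z L) (hg : HasLap g z M) :
    HasLap (fun z => f z + g z) z (L + M) := by
  obtain ⟨p, s, q, r, h₁, h₂, rfl⟩ := hf
  obtain ⟨p', s', q', r', h₁', h₂', rfl⟩ := hg
  exact ⟨_, _, _, _, h₁.add h₁', h₂.add h₂', by ring⟩

theorem HasLap.const_mul {f : ℂ → ℝ} {z : ℂ} {L : ℝ} (c : ℝ) (hf : HasLap f z L) :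
    HasLap (fun z => c * f z) z (c * L) := by
  obtain ⟨p, s, q, r, h₁, h₂, rfl⟩ := hf
  exact ⟨_, _, _, _, (HasJetTwo.const c).mul h₁, (HasJetTwo.const c).mul h₂, by ring⟩

theorem HasLap.const (c : ℝ) (z : ℂ) : HasLap (fun _ => c) z 0 :=
  ⟨_, _, _, _, HasJetTwo.const c, HasJetTwo.const c, by simp⟩

theorem HasLap.re (z : ℂ) : HasLap Complex.re z 0 :=
  ⟨1, 0, 0, 0, by simpa using HasJetTwo.affine z.re 1, by simpa using HasJetTwo.const z.re,
    by simp⟩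

theorem HasLap.re_sq_add_im_sq (z : ℂ) :
    HasLap (fun z => z.re * z.re + z.im * z.im) z 4 := by
  have h1 : HasJetTwo (fun t : ℝ => (z + t * 1).re) 1 0 := by
    simpa using HasJetTwo.affine z.re 1
  have h2 : HasJetTwo (fun t : ℝ => (z + t * 1).im) 0 0 := by
    simpa using HasJetTwo.const z.im
  have h3 : HasJetTwo (fun t : ℝ => (z + t * Complex.I).re) 0 0 := by
    simpa using HasJetTwo.const z.re
  have h4 : HasJetTwo (fun t : ℝ => (z + t * Complex.I).im) 1 0 := by
    simpa using HasJetTwo.affine z.im 1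
  exact ⟨_, _, _, _, (h1.mul h1).add (h2.mul h2), (h3.mul h3).add (h4.mul h4), by norm_num⟩

theorem HasLap.nonpos_of_isLocalMax {f : ℂ → ℝ} {z : ℂ} {L : ℝ} (hf : HasLap f z L)
    (hm : IsLocalMax f z) : L ≤ 0 := by
  obtain ⟨p, s, q, r, h₁, h₂, rfl⟩ := hf
  have key : ∀ e : ℂ, IsLocalMax (fun t : ℝ => f (z + t * e)) 0 := by
    intro e
    have : Filter.Tendsto (fun t : ℝ => z + t * e) (𝓝 0) (𝓝 z) := by
      have : Continuous fun t : ℝ => z + t * e := by fun_prop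
      simpa using this.tendsto 0
    filter_upwards [this.eventually hm] with t ht
    simpa using ht
  linarith [h₁.nonpos_of_isLocalMax (key _), h₂.nonpos_of_isLocalMax (key _)]

theorem HarmOn.hasLap {f : ℂ → ℝ} {Ω : Set ℂ} (hΩ : IsOpen Ω) (hf : ContDiffOn ℝ 2 f Ω)
    (h : HarmOn f Ω) {z : ℂ} (hz : z ∈ Ω) : HasLap f z 0 :=
  have hc := hf.contDiffAt (hΩ.mem_nhds hz)
  ⟨_, _, _, _, hc.hasJetTwo 1, hc.hasJetTwo Complex.I, h z hz⟩

/-- Squared distance to the vertical line through `a`. -/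
def horizSq (a x : R3) : ℝ := (x 0 + -a 0) * (x 0 + -a 0) + (x 1 + -a 1) * (x 1 + -a 1)

/-- The function `log r - x₃ ^ 2`, superharmonic on minimal surfaces where `r ≥ 1`. -/
def logHoriz (a x : R3) : ℝ := 1 / 2 * Real.log (horizSq a x) + -1 * (x 2 * x 2)

theorem continuous_horizSq (a : R3) : Continuous (horizSq a) := by
  unfold horizSq; fun_prop

namespace ConfMinImmOn

variable {ψ : ℂ → R3} {Ω : Set ℂ}

theorem contDiffOn_coord (h : ConfMinImmOn ψ Ω) (i : Fin 3) :
    ContDiffOn ℝ 2 (fun z => ψ z i) Ω := by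
  have := (EuclideanSpace.proj (𝕜 := ℝ) i : R3 →L[ℝ] ℝ).contDiff.comp_contDiffOn h.1
  exact this.of_le (WithTop.coe_le_coe.2 (le_top : (2 : ℕ∞) ≤ ⊤))

theorem conformal (h : ConfMinImmOn ψ Ω) (hΩ : IsOpen Ω) {z : ℂ} (hz : z ∈ Ω)
    {p q : Fin 3 → ℝ} (hp : ∀ i, p i = fderiv ℝ (fun z => ψ z i) z 1)
    (hq : ∀ i, q i = fderiv ℝ (fun z => ψ z i) z Complex.I) :
    p 0 ^ 2 + p 1 ^ 2 + p 2 ^ 2 = q 0 ^ 2 + q 1 ^ 2 + q 2 ^ 2 ∧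
      p 0 * q 0 + p 1 * q 1 + p 2 * q 2 = 0 := by
  obtain ⟨c, -, hc⟩ := h.2.2 z hz
  have hd : DifferentiableAt ℝ ψ z :=
    (h.1.contDiffAt (hΩ.mem_nhds hz)).differentiableAt (by simp)
  have hcoord : ∀ (i : Fin 3) (v : ℂ), fderiv ℝ (fun z => ψ z i) z v = fderiv ℝ ψ z v i := by
    intro i v
    have := ((EuclideanSpace.proj (𝕜 := ℝ) i).hasFDerivAt.comp z hd.hasFDerivAt).fderiv
    have h2 : (fun z => ψ z i) = (EuclideanSpace.proj (𝕜 := ℝ) i) ∘ ψ := rfl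
    rw [h2, this]; rfl
  have hsq : ∀ v : ℂ, (fderiv ℝ ψ z v 0) ^ 2 + (fderiv ℝ ψ z v 1) ^ 2 + (fderiv ℝ ψ z v 2) ^ 2
      = c ^ 2 * ‖v‖ ^ 2 := by
    intro v
    have := EuclideanSpace.norm_sq_eq (fderiv ℝ ψ z v)
    rw [hc v, Fin.sum_univ_three] at this
    simp only [Real.norm_eq_abs, sq_abs] at this
    rw [← this]; ring
  have h1 := hsq 1
  have h2 := hsq Complex.I
  have h3 := hsq (1 + Complex.I)
  have hn : ‖(1 : ℂ) + Complex.I‖ ^ 2 = 2 := by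
    rw [Complex.sq_norm, Complex.normSq_apply]; norm_num
  rw [hn] at h3
  simp only [map_add, PiLp.add_apply, norm_one, Complex.norm_I] at h1 h2 h3
  simp only [hp, hq, hcoord]
  constructor <;> linarith

theorem exists_hasLap_logHoriz (h : ConfMinImmOn ψ Ω) (hΩ : IsOpen Ω) {z : ℂ} (hz : z ∈ Ω)
    {a : R3} (ha : 1 ≤ horizSq a (ψ z)) :
    ∃ L ≤ 0, HasLap (fun z => logHoriz a (ψ z)) z L := by
  have hc := fun i => (h.contDiffOn_coord i).contDiffAt (hΩ.mem_nhds hz)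
  have jet := fun (i : Fin 3) (e : ℂ) => (hc i).hasJetTwo e
  have hL := fun i => h.2.1 i z hz
  have hconf := h.conformal hΩ hz (fun _ => rfl) (fun _ => rfl)
  generalize hpe : (fun (i : Fin 3) (e : ℂ) => fderiv ℝ (fun z => ψ z i) z e) = p at *
  generalize hse : (fun (i : Fin 3) (e : ℂ) =>
    fderiv ℝ (fun w => fderiv ℝ (fun z => ψ z i) w e) z e) = s at *
  have hp : ∀ i e, fderiv ℝ (fun z => ψ z i) z e = p i e := fun i e => by rw [← hpe]
  have hs : ∀ i e, fderiv ℝ (fun w => fderiv ℝ (fun z => ψ z i) w e) z e = s i e :=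
    fun i e => by rw [← hse]
  simp only [hp, hs] at jet hL hconf
  have j0 := fun e => (jet 0 e).add (HasJetTwo.const (-a 0))
  have j1 := fun e => (jet 1 e).add (HasJetTwo.const (-a 1))
  have hne : horizSq a (ψ z) ≠ 0 := by linarith
  have jρ := fun e => ((j0 e).mul (j0 e)).add ((j1 e).mul (j1 e))
  have jl := fun e => (((HasJetTwo.const (1 / 2)).mul ((jρ e).log (by simpa [horizSq] using hne))).add
    ((HasJetTwo.const (-1)).mul ((jet 2 e).mul (jet 2 e))))
  refine ⟨_, ?_, _, _, _, _, jl 1, jl Complex.I, rfl⟩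
  have hρ : horizSq a (ψ z) = (ψ z 0 + -a 0) ^ 2 + (ψ z 1 + -a 1) ^ 2 := by
    unfold horizSq; ring
  have ineq := conformal_inequality (x₁ := ψ z 0 + -a 0) (x₂ := ψ z 1 + -a 1) hconf.1 hconf.2
    (hρ ▸ ha)
  rw [hρ] at ha
  simp only [Complex.ofReal_zero, zero_mul, add_zero, zero_add, ← pow_two]
  generalize ψ z 0 + -a 0 = x at *
  generalize ψ z 1 + -a 1 = y at *
  have h0 := hL 0
  have h1 := hL 1
  have h2 := hL 2
  refine le_trans (le_of_eq ?_) ineq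
  have hxy : x ^ 2 + y ^ 2 ≠ 0 := by linarith
  rw [← eq_neg_iff_add_eq_zero] at h0 h1 h2
  rw [h0, h1, h2]
  field_simp
  ring

end ConfMinImmOn

theorem R3.norm_sq_eq (x : R3) : ‖x‖ ^ 2 = x 0 ^ 2 + x 1 ^ 2 + x 2 ^ 2 := by
  rw [EuclideanSpace.norm_sq_eq, Fin.sum_univ_three]
  simp only [Real.norm_eq_abs, sq_abs]

theorem norm_sub_sq_le_of_horizSq_le {a x : R3} {N : ℝ} (h : horizSq a x ≤ N) :
    ‖x - a‖ ^ 2 ≤ N + (x 2 - a 2) ^ 2 := by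
  rw [R3.norm_sq_eq]
  simp only [PiLp.sub_apply]
  unfold horizSq at h
  linarith

/-- If the horizontal distance and the height are bounded, so is the norm. -/
theorem exists_norm_le_of_horizSq_le (a : R3) (N c : ℝ) :
    ∃ M : ℝ, ∀ x : R3, 0 < x 2 → x 2 ≤ c → horizSq a x ≤ N → ‖x‖ ≤ M := by
  refine ⟨‖a‖ + √(N + (|c| + |a 2|) ^ 2), fun x h0 hc hN => ?_⟩
  have h1 : ‖x - a‖ ≤ √(N + (|c| + |a 2|) ^ 2) := by
    refine Real.le_sqrt_of_sq_le ((norm_sub_sq_le_of_horizSq_le hN).trans ?_)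
    have h2 : |x 2 - a 2| ≤ |c| + |a 2| :=
      (abs_sub _ _).trans (by rw [abs_of_pos h0]; gcongr; exact hc.trans (le_abs_self c))
    have := pow_le_pow_left₀ (abs_nonneg _) h2 2
    rw [sq_abs] at this
    linarith
  calc ‖x‖ = ‖a + (x - a)‖ := by rw [add_sub_cancel]
    _ ≤ ‖a‖ + ‖x - a‖ := norm_add_le _ _
    _ ≤ _ := by gcongr

/-- Parabolicity: for a conformal minimal disk in the half-space which tends to infinity at the
boundary, a harmonic function bounded above cannot be positive only where the height is bounded
and the distance to a fixed vertical line exceeds one. -/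
theorem ConfMinImmOn.nonpos_of_hasLap {ψ : ℂ → R3} (h : ConfMinImmOn ψ (ball (0 : ℂ) 1))
    (hpos : ∀ z ∈ ball (0 : ℂ) 1, 0 < ψ z 2)
    (hprop : ∀ M : ℝ, ∃ K ⊆ ball (0 : ℂ) 1, IsCompact K ∧
      ∀ z ∈ ball (0 : ℂ) 1, ‖ψ z‖ ≤ M → z ∈ K)
    (a : R3) (c C : ℝ) {v : ℂ → ℝ} (hv : ContinuousOn v (ball (0 : ℂ) 1))
    (hlap : ∀ z ∈ ball (0 : ℂ) 1, HasLap v z 0) (hC : ∀ z ∈ ball (0 : ℂ) 1, v z ≤ C)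
    (hreg : ∀ z ∈ ball (0 : ℂ) 1, 0 < v z → ψ z 2 ≤ c ∧ 1 < horizSq a (ψ z)) :
    ∀ z ∈ ball (0 : ℂ) 1, v z ≤ 0 := by
  intro z₁ hz₁
  by_contra! hv₁
  set V := v z₁ with hV
  have hψ : ContinuousOn ψ (ball (0 : ℂ) 1) := h.1.continuousOn
  let u : ℂ → ℝ := fun z => logHoriz a (ψ z) + c ^ 2
  have hu0 : ∀ z ∈ ball (0 : ℂ) 1, 0 < v z →
      0 ≤ u z ∧ 1 / 2 * Real.log (horizSq a (ψ z)) ≤ u z := by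
    intro z hz hvz
    obtain ⟨h1, h2⟩ := hreg z hz hvz
    have h3 := hpos z hz
    have h4 := Real.log_pos h2
    have h5 : ψ z 2 * ψ z 2 ≤ c ^ 2 := by nlinarith
    simp only [u, logHoriz]
    constructor <;> linarith
  have hulap : ∀ z ∈ ball (0 : ℂ) 1, 0 < v z → ∃ L ≤ 0, HasLap u z L := by
    intro z hz hvz
    obtain ⟨L, hL, hl⟩ := h.exists_hasLap_logHoriz isOpen_ball hz (hreg z hz hvz).2.le
    exact ⟨L, hL, by simpa using hl.add (HasLap.const (c ^ 2) z)⟩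
  have hucont : ContinuousOn u {z ∈ ball (0 : ℂ) 1 | 0 < v z} := by
    have hψ' := hψ.mono (sep_subset (ball (0 : ℂ) 1) fun z => 0 < v z)
    have hρ := (continuous_horizSq a).comp_continuousOn hψ'
    have h2 : ContinuousOn (fun z => ψ z 2) {z ∈ ball (0 : ℂ) 1 | 0 < v z} :=
      (EuclideanSpace.proj (𝕜 := ℝ) (2 : Fin 3) : R3 →L[ℝ] ℝ).continuous.comp_continuousOn hψ'
    have hl := hρ.log fun z hz => (zero_lt_one.trans (hreg z hz.1 hz.2).2).ne'
    exact ((hl.const_mul (1 / 2)).add ((h2.mul h2).const_mul (-1))).add_const _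
  obtain ⟨hu₁, -⟩ := hu0 z₁ hz₁ hv₁
  obtain ⟨ε, hε, hεu⟩ : ∃ ε > 0, ε * u z₁ ≤ V / 4 :=
    ⟨V / 4 / (u z₁ + 1), by positivity, by
      rw [div_mul_eq_mul_div, div_le_iff₀ (by positivity)]; nlinarith⟩
  let w : ℂ → ℝ := fun z => v z + -ε * u z + V / 4 * (z.re * z.re + z.im * z.im)
  have hnorm : ∀ z ∈ ball (0 : ℂ) 1, z.re * z.re + z.im * z.im < 1 := by
    intro z hz
    rw [mem_ball_zero_iff] at hz
    rw [← Complex.normSq_apply, Complex.normSq_eq_norm_sq]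
    nlinarith [norm_nonneg z]
  have hw₁ : 3 / 4 * V ≤ w z₁ := by
    have : 0 ≤ z₁.re * z₁.re + z₁.im * z₁.im := by nlinarith
    simp only [w]
    nlinarith
  obtain ⟨M, hM⟩ := exists_norm_le_of_horizSq_le a (Real.exp (2 * ((C + V / 4) / ε))) c
  obtain ⟨K, hKB, hK, hKM⟩ := hprop M
  have hwK : ∀ z ∈ ball (0 : ℂ) 1, 0 < v z → 3 / 4 * V ≤ w z → z ∈ K ∧ V / 2 < v z := by
    intro z hz hvz hwz
    obtain ⟨h1, h2⟩ := hu0 z hz hvz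
    obtain ⟨h3, h4⟩ := hreg z hz hvz
    have h5 := hnorm z hz
    have h6 := hC z hz
    simp only [w] at hwz
    have h7 : 0 ≤ ε * u z := by positivity
    refine ⟨hKM z hz (hM _ (hpos z hz) h3 ?_), by nlinarith⟩
    rw [← Real.log_le_iff_le_exp (by linarith)]
    have : u z ≤ (C + V / 4) / ε := by
      rw [le_div_iff₀ hε]; nlinarith
    linarith
  let T : Set ℂ := K ∩ v ⁻¹' Ici (V / 2)
  have hT : IsCompact T := hK.of_isClosed_subset
    ((hv.mono hKB).preimage_isClosed_of_isClosed hK.isClosed isClosed_Ici) inter_subset_left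
  have hTsub : T ⊆ {z ∈ ball (0 : ℂ) 1 | 0 < v z} := fun z hz =>
    ⟨hKB hz.1, by have : V / 2 ≤ v z := hz.2
                  linarith⟩
  have hwcont : ContinuousOn w T :=
    ((hv.mono (hTsub.trans (sep_subset _ _))).add ((hucont.mono hTsub).const_mul (-ε))).add
      (by fun_prop)
  have hz₁T : z₁ ∈ T := by
    obtain ⟨h1, h2⟩ := hwK z₁ hz₁ hv₁ hw₁
    exact ⟨h1, h2.le⟩
  obtain ⟨z, hzT, hzmax⟩ := hT.exists_isMaxOn ⟨z₁, hz₁T⟩ hwcont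
  have hzB := (hTsub hzT).1
  have hvz := (hTsub hzT).2
  have hwz : 3 / 4 * V ≤ w z := hw₁.trans (hzmax hz₁T)
  have hlocal : IsLocalMax w z := by
    have h1 := isOpen_ball.mem_nhds hzB
    filter_upwards [h1, (hv.continuousAt h1).eventually (lt_mem_nhds (hwK z hzB hvz hwz).2)]
      with y hy hvy
    by_cases hyw : 3 / 4 * V ≤ w y
    · exact hzmax ⟨(hwK y hy (by linarith) hyw).1, hvy.le⟩
    · linarith
  obtain ⟨L, hL, hl⟩ := hulap z hzB hvz
  have hfin := (((hlap z hzB).add (hl.const_mul (-ε))).add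
    ((HasLap.re_sq_add_im_sq z).const_mul (V / 4))).nonpos_of_isLocalMax hlocal
  nlinarith

/-- A conformal minimal disk cannot lie properly in the upper half-space of `ℝ³`. -/
theorem ConfMinImmOn.false_of_proper_halfspace {ψ : ℂ → R3}
    (h : ConfMinImmOn ψ (ball (0 : ℂ) 1)) (hpos : ∀ z ∈ ball (0 : ℂ) 1, 0 < ψ z 2)
    (hprop : ∀ M : ℝ, ∃ K ⊆ ball (0 : ℂ) 1, IsCompact K ∧
      ∀ z ∈ ball (0 : ℂ) 1, ‖ψ z‖ ≤ M → z ∈ K) : False := by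
  have hψ : ContinuousOn ψ (ball (0 : ℂ) 1) := h.1.continuousOn
  have h0B : (0 : ℂ) ∈ ball (0 : ℂ) 1 := mem_ball_self one_pos
  have hh := h.contDiffOn_coord 2
  set c := ψ 0 2 with hc
  set a := ψ 0 with ha
  have hK' : IsCompact (ball (0 : ℂ) 1 ∩ ψ ⁻¹' {x : R3 | horizSq a x ≤ 1 ∧ x 2 ≤ c}) := by
    obtain ⟨M, hM⟩ := exists_norm_le_of_horizSq_le a 1 c
    obtain ⟨K, hKB, hK, hKM⟩ := hprop M
    have hcl : IsClosed {x : R3 | horizSq a x ≤ 1 ∧ x 2 ≤ c} :=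
      (isClosed_le (continuous_horizSq a) continuous_const).inter
        (isClosed_le (EuclideanSpace.proj (𝕜 := ℝ) (2 : Fin 3) : R3 →L[ℝ] ℝ).continuous
          continuous_const)
    have : ball (0 : ℂ) 1 ∩ ψ ⁻¹' {x : R3 | horizSq a x ≤ 1 ∧ x 2 ≤ c}
        = K ∩ ψ ⁻¹' {x : R3 | horizSq a x ≤ 1 ∧ x 2 ≤ c} := by
      ext z
      exact ⟨fun hz => ⟨hKM z hz.1 (hM _ (hpos z hz.1) hz.2.2 hz.2.1), hz.2⟩,
        fun hz => ⟨hKB hz.1, hz.2⟩⟩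
    rw [this]
    exact hK.of_isClosed_subset
      ((hψ.mono hKB).preimage_isClosed_of_isClosed hK.isClosed hcl) inter_subset_left
  set S := ball (0 : ℂ) 1 ∩ ψ ⁻¹' {x : R3 | horizSq a x ≤ 1 ∧ x 2 ≤ c} with hS
  have h0S : (0 : ℂ) ∈ S := ⟨h0B, by simp [horizSq, ← ha], hc.ge⟩
  have hSB : S ⊆ ball (0 : ℂ) 1 := inter_subset_left
  obtain ⟨z₀, hz₀, hmin⟩ := hK'.exists_isMinOn ⟨0, h0S⟩ (hh.continuousOn.mono hSB)
  have hm : ψ z₀ 2 ≤ c := hz₀.2.2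
  have hge : ∀ z ∈ ball (0 : ℂ) 1, ψ z₀ 2 + -1 * ψ z 2 ≤ 0 := by
    refine h.nonpos_of_hasLap hpos hprop a c (ψ z₀ 2)
      (continuousOn_const.add (hh.continuousOn.const_mul (-1))) (fun z hz => ?_)
      (fun z hz => by linarith [hpos z hz]) (fun z hz hvz => ?_)
    · simpa using (HasLap.const (ψ z₀ 2) z).add
        (((h.2.1 2).hasLap isOpen_ball hh hz).const_mul (-1))
    · refine ⟨by linarith, ?_⟩
      by_contra! hr
      have : ψ z₀ 2 ≤ ψ z 2 := hmin (show z ∈ S from ⟨hz, hr, by linarith⟩)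
      linarith
  have hconst : ∀ z ∈ ball (0 : ℂ) 1, ψ z 2 = ψ z₀ 2 := by
    intro z hz
    have := ((h.2.1 2).harmonicOnNhd isOpen_ball hh).neg.eqOn_const_of_isMaxOn (hSB hz₀)
      (fun y hy => by
        have := hge y hy
        simp only [mem_ofPred_eq, Pi.neg_apply]
        linarith) z hz
    simpa using this
  obtain ⟨z₁, hz₁, hmax⟩ := hK'.exists_isMaxOn ⟨0, h0S⟩ Complex.continuous_re.continuousOn
  have hre : ∀ z ∈ ball (0 : ℂ) 1, z.re + -z₁.re ≤ 0 := by
    refine h.nonpos_of_hasLap hpos hprop a c (1 + -z₁.re) (by fun_prop) (fun z hz => ?_)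
      (fun z hz => ?_) (fun z hz hvz => ?_)
    · simpa using (HasLap.re z).add (HasLap.const (-z₁.re) z)
    · have := Complex.re_le_norm z
      rw [mem_ball_zero_iff] at hz
      linarith
    · have hle : ψ z 2 ≤ c := (hconst z hz).trans_le hm
      refine ⟨hle, ?_⟩
      by_contra! hr
      have : z.re ≤ z₁.re := hmax (show z ∈ S from ⟨hz, hr, hle⟩)
      linarith
  have hz₁' : z₁.re < 1 := (Complex.re_le_norm z₁).trans_lt (by simpa using hSB hz₁)
  have hz₁0 : 0 ≤ z₁.re := by simpa using hmax h0S
  have := hre (((z₁.re + 1) / 2 : ℝ) : ℂ) (by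
    rw [mem_ball_zero_iff, Complex.norm_real, Real.norm_of_nonneg (by linarith)]
    linarith)
  rw [Complex.ofReal_re] at this
  linarith

theorem isPreconnected_ball_one_inter_lt_norm {s : ℝ} (hs : 0 ≤ s) :
    IsPreconnected {z : ℂ | z ∈ ball (0 : ℂ) 1 ∧ s < ‖z‖} := by
  have : {z : ℂ | z ∈ ball (0 : ℂ) 1 ∧ s < ‖z‖}
      = (fun p : ℝ × ℝ => (p.1 : ℂ) * Complex.exp (p.2 * Complex.I)) '' (Ioo s 1 ×ˢ univ) := by
    ext z
    constructor
    · rintro ⟨h1, h2⟩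
      exact ⟨(‖z‖, z.arg), ⟨⟨h2, by simpa using h1⟩, mem_univ _⟩, Complex.norm_mul_exp_arg_mul_I z⟩
    · rintro ⟨⟨r, θ⟩, ⟨⟨h1, h2⟩, -⟩, rfl⟩
      have : ‖(r : ℂ) * Complex.exp (θ * Complex.I)‖ = r := by
        rw [norm_mul, Complex.norm_exp_ofReal_mul_I, mul_one, Complex.norm_real,
          Real.norm_of_nonneg (hs.trans h1.le)]
      refine ⟨?_, ?_⟩
      · rw [mem_ball_zero_iff]; exact this.trans_lt h2
      · exact h1.trans_eq this.symm
  rw [this]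
  exact (isPreconnected_Ioo.prod isPreconnected_univ).image _ (by fun_prop)

/-- A bounded conformal minimal disk cannot be proper in the upper half-space. -/
theorem ConfMinImmOn.false_of_bounded {ψ : ℂ → R3} (h : ConfMinImmOn ψ (ball (0 : ℂ) 1))
    (hpos : ∀ z ∈ ball (0 : ℂ) 1, 0 < ψ z 2)
    (hprop : ProperIn ψ (ball (0 : ℂ) 1) {x : R3 | 0 < x 2})
    {M : ℝ} (hM : ∀ z ∈ ball (0 : ℂ) 1, ‖ψ z‖ ≤ M) : False := by
  have h0B : (0 : ℂ) ∈ ball (0 : ℂ) 1 := mem_ball_self one_pos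
  have hh := h.contDiffOn_coord 2
  have hK : IsCompact (closedBall (0 : R3) M ∩ {x : R3 | ψ 0 2 ≤ x 2}) :=
    (isCompact_closedBall _ _).inter_right (isClosed_le continuous_const (by fun_prop))
  have hS := hprop _ hK fun x hx => (hpos 0 h0B).trans_le hx.2
  have hmem : ∀ z ∈ ball (0 : ℂ) 1, ψ 0 2 ≤ ψ z 2 →
      z ∈ ball (0 : ℂ) 1 ∩ ψ ⁻¹' (closedBall (0 : R3) M ∩ {x : R3 | ψ 0 2 ≤ x 2}) :=
    fun z hz hle => ⟨hz, by simpa using hM z hz, hle⟩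
  obtain ⟨z₀, hz₀, hmax⟩ := hS.exists_isMaxOn ⟨0, hmem 0 h0B le_rfl⟩
    (hh.continuousOn.mono inter_subset_left)
  have hz₀' : ψ 0 2 ≤ ψ z₀ 2 := hz₀.2.2
  have hconst := ((h.2.1 2).harmonicOnNhd isOpen_ball hh).eqOn_const_of_isMaxOn hz₀.1
    (fun z hz => by
      rcases le_total (ψ 0 2) (ψ z 2) with hle | hle
      · exact hmax (hmem z hz hle)
      · exact hle.trans hz₀')
  have heq : ball (0 : ℂ) 1 ∩ ψ ⁻¹' (closedBall (0 : R3) M ∩ {x : R3 | ψ 0 2 ≤ x 2})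
      = ball (0 : ℂ) 1 :=
    inter_subset_left.antisymm fun z hz => hmem z hz (hz₀'.trans (hconst z hz).ge)
  rw [heq] at hS
  have hcl := hS.isClosed.closure_eq
  rw [closure_ball _ one_ne_zero] at hcl
  have : (1 : ℂ) ∈ ball (0 : ℂ) 1 := hcl ▸ (by simp)
  simp at this

/-- Outside the ball containing the limit set, the ends of a properly immersed disk do not cross
a sphere. -/
theorem ProperIn.norm_lt_or_lt_norm_near_boundary {ψ : ℂ → R3}
    (hψ : ContinuousOn ψ (ball (0 : ℂ) 1)) (hpos : ∀ z ∈ ball (0 : ℂ) 1, 0 < ψ z 2)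
    (hprop : ProperIn ψ (ball (0 : ℂ) 1) {x : R3 | 0 < x 2}) {R R' : ℝ}
    (hR : limitSet ψ ⊆ closedBall 0 R) (hRR' : R < R') :
    ∃ s < 1, (∀ z ∈ ball (0 : ℂ) 1, s < ‖z‖ → ‖ψ z‖ < R') ∨
      ∀ z ∈ ball (0 : ℂ) 1, s < ‖z‖ → R' < ‖ψ z‖ := by
  have hKimage : closure (ψ '' ball (0 : ℂ) 1) ∩ sphere 0 R' ⊆ ψ '' ball (0 : ℂ) 1 := by
    rintro x ⟨hx, hxs⟩
    by_contra hn
    have h1 := hR ⟨hx, hn⟩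
    rw [mem_closedBall_zero_iff] at h1
    rw [mem_sphere_zero_iff_norm] at hxs
    linarith
  have hS := hprop _ ((isCompact_sphere (0 : R3) R').inter_left isClosed_closure) (by
    intro x hx
    obtain ⟨z, hz, rfl⟩ := hKimage hx
    exact hpos z hz)
  obtain ⟨s', hs'1, hs'⟩ := exists_lt_subset_ball hS.isClosed inter_subset_left
  refine ⟨max s' 0, max_lt hs'1 one_pos, ?_⟩
  by_contra! hcon
  obtain ⟨⟨y, hy, hsy, hyR⟩, x, hx, hsx, hxR⟩ := hcon
  have hsub : {z : ℂ | z ∈ ball (0 : ℂ) 1 ∧ max s' 0 < ‖z‖} ⊆ ball (0 : ℂ) 1 := fun z hz => hz.1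
  obtain ⟨z, ⟨hz, hsz⟩, hzR⟩ :=
    (isPreconnected_ball_one_inter_lt_norm (le_max_right s' 0)).intermediate_value
      (show x ∈ _ from ⟨hx, hsx⟩) (show y ∈ _ from ⟨hy, hsy⟩) (hψ.mono hsub).norm ⟨hxR, hyR⟩
  have := hs' ⟨hz, subset_closure ⟨z, hz, rfl⟩, by simpa using hzR⟩
  rw [mem_ball_zero_iff] at this
  exact absurd ((le_max_left s' 0).trans_lt hsz) this.not_gt

/-- No complete proper conformal minimal disk in the open halfspace `{x₃ > 0}` has a
bounded limit set. -/
theorem statement9 :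
    ¬ ∃ ψ : ℂ → R3,
        ConfMinImmOn ψ (ball (0:ℂ) 1) ∧
        CompleteOn ψ (ball (0:ℂ) 1) ∧
        MapsTo ψ (ball (0:ℂ) 1) {x : R3 | 0 < x 2} ∧
        ProperIn ψ (ball (0:ℂ) 1) {x : R3 | 0 < x 2} ∧
        Bornology.IsBounded (limitSet ψ) := by
  rintro ⟨ψ, h, -, hpos, hprop, hbdd⟩
  replace hpos : ∀ z ∈ ball (0 : ℂ) 1, 0 < ψ z 2 := fun z hz => hpos hz
  have hψ : ContinuousOn ψ (ball (0 : ℂ) 1) := h.1.continuousOn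
  obtain ⟨R, hR⟩ := hbdd.subset_closedBall 0
  by_cases hcase : ∃ R' s : ℝ, s < 1 ∧ ∀ z ∈ ball (0 : ℂ) 1, s < ‖z‖ → ‖ψ z‖ < R'
  · obtain ⟨R', s, hs, hlt⟩ := hcase
    obtain ⟨C, hC⟩ := (isCompact_closedBall (0 : ℂ) s).exists_bound_of_continuousOn
      (hψ.mono (closedBall_subset_ball hs))
    refine h.false_of_bounded hpos hprop (M := max C R') fun z hz => ?_
    rcases le_or_gt ‖z‖ s with hzs | hzs
    · exact (hC z (by simpa using hzs)).trans (le_max_left _ _)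
    · exact (hlt z hz hzs).le.trans (le_max_right _ _)
  · refine h.false_of_proper_halfspace hpos fun M => ?_
    obtain ⟨s, hs, hd⟩ := hprop.norm_lt_or_lt_norm_near_boundary hψ hpos hR
      ((le_max_left R M).trans_lt (lt_add_one _))
    have hd' := hd.resolve_left fun hl => hcase ⟨_, s, hs, hl⟩
    refine ⟨closedBall 0 s, closedBall_subset_ball hs, isCompact_closedBall _ _, fun z hz hM => ?_⟩
    rw [mem_closedBall_zero_iff]
    by_contra! hsz
    linarith [hd' z hz hsz, le_max_right R M]
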